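/- arXiv:2408.13246 — 2 statements merged into one kernel-verified Lean document; each statement's English description precedes it below -/
import Mathlib

section
/- For all ν, c ∈ ℂ and all z ∈ ℂ with z ≠ 0: z² E_{ν,c}(z) = z^{ν+2}/Γ(ν+1) + c z^{ν+3}/Γ(ν+2) + c³ z² E_{ν+3,c}(z) + c² (ν+3)(ν+4) · ( E_{ν+4,c}(z) − c E_{ν+5,c}(z) ). -/
/-- The complex Miller-Ross function `E_{ν,c}(z) = z^ν ∑_{n=0}^∞ (cz)^n / Γ(ν+n+1)`,
using the principal complex power and the convention `1/Γ(m) = 0` at nonpositive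
integers `m` (in Mathlib `Complex.Gamma` vanishes there, and division by `0` is `0`). -/
noncomputable def millerRoss (ν c z : ℂ) : ℂ :=
  z ^ ν * ∑' n : ℕ, (c * z) ^ n / Complex.Gamma (ν + n + 1)

open Filter in
/-- The Miller-Ross power series converges everywhere. -/
lemma summable_pow_div_Gamma (ν w : ℂ) :
    Summable fun n : ℕ => w ^ n / Complex.Gamma (ν + n + 1) := by
  have hlim : Tendsto (fun n : ℕ => ‖ν + n + 1‖) atTop atTop := by
    have h : Tendsto (fun n : ℕ => (n : ℝ) - ‖ν + 1‖) atTop atTop :=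
      tendsto_atTop_add_const_right _ _ tendsto_natCast_atTop_atTop
    refine tendsto_atTop_mono (fun n => ?_) h
    have h1 := norm_sub_norm_le (n : ℂ) (-(ν + 1))
    rw [norm_neg, Complex.norm_natCast] at h1
    calc (n : ℝ) - ‖ν + 1‖ ≤ ‖(n : ℂ) - -(ν + 1)‖ := h1
      _ = ‖ν + n + 1‖ := by congr 1; ring
  refine summable_of_ratio_norm_eventually_le (r := 1 / 2) (by norm_num) ?_
  filter_upwards [hlim.eventually_ge_atTop (2 * ‖w‖ + 1)] with n hn
  have hG := Complex.one_div_Gamma_eq_self_mul_one_div_Gamma_add_one (ν + n + 1)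
  have hrec : w * (w ^ n / Complex.Gamma (ν + n + 1)) =
      (ν + n + 1) * (w ^ (n + 1) / Complex.Gamma (ν + (n + 1 : ℕ) + 1)) := by
    rw [div_eq_mul_one_div, div_eq_mul_one_div (w ^ (n + 1)), one_div, one_div, hG,
      show ν + ((n + 1 : ℕ) : ℂ) + 1 = ν + n + 1 + 1 by push_cast; ring]
    ring
  have hnorm := congrArg norm hrec
  rw [norm_mul, norm_mul] at hnorm
  have h0 := norm_nonneg w
  have ha := norm_nonneg (w ^ n / Complex.Gamma (ν + n + 1))
  have hb := norm_nonneg (w ^ (n + 1) / Complex.Gamma (ν + (n + 1 : ℕ) + 1))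
  generalize ‖w ^ n / Complex.Gamma (ν + n + 1)‖ = a at *
  generalize ‖w ^ (n + 1) / Complex.Gamma (ν + (n + 1 : ℕ) + 1)‖ = b at *
  by_contra! hlt
  nlinarith [mul_le_mul_of_nonneg_right hn hb, mul_nonneg h0 hb]

/-- Splitting off the first term of the Miller-Ross series. -/
lemma millerRoss_eq_add (ν c z : ℂ) (hz : z ≠ 0) :
    millerRoss ν c z = z ^ ν / Complex.Gamma (ν + 1) + c * millerRoss (ν + 1) c z := by
  have hshift : ∑' n : ℕ, (c * z) ^ (n + 1) / Complex.Gamma (ν + (n + 1 : ℕ) + 1) =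
      c * z * ∑' n : ℕ, (c * z) ^ n / Complex.Gamma (ν + 1 + n + 1) := by
    rw [← tsum_mul_left]
    refine tsum_congr fun n => ?_
    rw [show ν + ((n + 1 : ℕ) : ℂ) + 1 = ν + 1 + n + 1 by push_cast; ring]
    ring
  rw [millerRoss, millerRoss, (summable_pow_div_Gamma ν (c * z)).tsum_eq_zero_add, hshift,
    Complex.cpow_add _ _ hz, Complex.cpow_one]
  simp only [pow_zero, Nat.cast_zero, add_zero]
  ring

/-- Recurrence: `z² E_{ν,c}(z) = z^{ν+2}/Γ(ν+1) + c z^{ν+3}/Γ(ν+2)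
  + c³ z² E_{ν+3,c}(z) + c²(ν+3)(ν+4)(E_{ν+4,c}(z) − c E_{ν+5,c}(z))`. -/
theorem millerRoss_rec_iv (ν c z : ℂ) (hz : z ≠ 0) :
    z ^ 2 * millerRoss ν c z =
      z ^ (ν + 2) / Complex.Gamma (ν + 1) + c * z ^ (ν + 3) / Complex.Gamma (ν + 2) +
        c ^ 3 * z ^ 2 * millerRoss (ν + 3) c z +
        c ^ 2 * (ν + 3) * (ν + 4) *
          (millerRoss (ν + 4) c z - c * millerRoss (ν + 5) c z) := by
  have h0 := millerRoss_eq_add ν c z hz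
  have h1 := millerRoss_eq_add (ν + 1) c z hz
  have h2 := millerRoss_eq_add (ν + 2) c z hz
  have h4 := millerRoss_eq_add (ν + 4) c z hz
  have g3 := Complex.one_div_Gamma_eq_self_mul_one_div_Gamma_add_one (ν + 3)
  have g4 := Complex.one_div_Gamma_eq_self_mul_one_div_Gamma_add_one (ν + 4)
  rw [show ν + 1 + 1 = ν + 2 by ring] at h1
  rw [show ν + 2 + 1 = ν + 3 by ring] at h2
  rw [show ν + 4 + 1 = ν + 5 by ring] at h4 g4
  rw [show ν + 3 + 1 = ν + 4 by ring] at g3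
  have p1 : z ^ (ν + 1) = z ^ ν * z := by rw [Complex.cpow_add _ _ hz, Complex.cpow_one]
  have p2 : z ^ (ν + 2) = z ^ ν * z ^ 2 := by
    rw [Complex.cpow_add _ _ hz]; norm_cast
  have p3 : z ^ (ν + 3) = z ^ ν * z ^ 3 := by
    rw [Complex.cpow_add _ _ hz]; norm_cast
  have p4 : z ^ (ν + 4) = z ^ ν * z ^ 4 := by
    rw [Complex.cpow_add _ _ hz]; norm_cast
  rw [h0, h1, h2, h4, p1, p2, p3, p4]
  simp only [div_eq_mul_inv] at g3 g4 ⊢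
  rw [g3, g4]
  ring
end

section
/- Let ν, c ∈ ℂ, let m be a positive integer, and let k ∈ ℕ. For every z ∈ ℂ lying off the nonpositive real axis (that is, Re(z) > 0 or Im(z) ≠ 0), the k-th complex derivative satisfies (d^k/dz^k) E_{ν+m,c}(z) = E_{ν+m−k,c}(z). -/
open Filter in
/-- The Taylor coefficients of the entire factor of the Miller-Ross function are summable
against every geometric sequence. -/
lemma summable_pow_div_Gamma_add (ν x : ℂ) :
    Summable fun n : ℕ => x ^ n / Complex.Gamma (ν + n + 1) := by
  refine summable_of_ratio_norm_eventually_le (r := 1 / 2) (by norm_num) ?_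
  filter_upwards [eventually_ge_atTop ⌈2 * ‖x‖ + ‖ν + 1‖⌉₊] with n hn
  have hlarge : 2 * ‖x‖ ≤ ‖ν + n + 1‖ := by
    have h1 : 2 * ‖x‖ + ‖ν + 1‖ ≤ n := Nat.ceil_le.mp hn
    have h2 : ‖(n : ℂ)‖ ≤ ‖ν + n + 1‖ + ‖ν + 1‖ := by
      calc ‖(n : ℂ)‖ = ‖(ν + n + 1) - (ν + 1)‖ := by congr 1; ring
        _ ≤ _ := norm_sub_le _ _
    rw [Complex.norm_natCast] at h2
    linarith
  have hrec : (Complex.Gamma (ν + n + 1))⁻¹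
      = (ν + n + 1) * (Complex.Gamma (ν + (n + 1 : ℕ) + 1))⁻¹ := by
    rw [Complex.one_div_Gamma_eq_self_mul_one_div_Gamma_add_one]
    push_cast
    ring_nf
  rw [div_eq_mul_inv, div_eq_mul_inv (x ^ n), hrec, pow_succ]
  simp only [norm_mul]
  have := mul_le_mul_of_nonneg_right hlarge
    (mul_nonneg (norm_nonneg (x ^ n)) (norm_nonneg (Complex.Gamma (ν + (n + 1 : ℕ) + 1))⁻¹))
  linarith

/-- Differentiating the Miller-Ross function lowers its order by one. -/
lemma hasDerivAt_millerRoss (ν c : ℂ) {z : ℂ} (hz : z ∈ Complex.slitPlane) :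
    HasDerivAt (millerRoss ν c) (millerRoss (ν - 1) c z) z := by
  have hz0 : z ≠ 0 := Complex.slitPlane_ne_zero hz
  set R : ℝ := ‖z‖ + 1
  have hzR : z ∈ Metric.ball (0 : ℂ) R := by simp [R]
  have hR : 0 ≤ R := by positivity
  have hu := (summable_pow_div_Gamma_add ν (c * R)).norm
  have hd : ∀ (n : ℕ) (w : ℂ), HasDerivAt (fun w : ℂ => (c * w) ^ n / Complex.Gamma (ν + n + 1))
      (n * (c * w) ^ (n - 1) * c / Complex.Gamma (ν + n + 1)) w := fun n w => by
    simpa using (((hasDerivAt_id w).const_mul c).pow n).div_const (Complex.Gamma (ν + n + 1))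
  have hdiff : ∀ n : ℕ, DifferentiableOn ℂ
      (fun w : ℂ => (c * w) ^ n / Complex.Gamma (ν + n + 1)) (Metric.ball 0 R) :=
    fun n w _ => (hd n w).differentiableAt.differentiableWithinAt
  have hbound : ∀ (n : ℕ) (w : ℂ), w ∈ Metric.ball (0 : ℂ) R →
      ‖(c * w) ^ n / Complex.Gamma (ν + n + 1)‖ ≤ ‖(c * R) ^ n / Complex.Gamma (ν + n + 1)‖ := by
    intro n w hw
    have hw' : ‖w‖ ≤ R := (mem_ball_zero_iff.mp hw).le
    simp only [norm_div, norm_pow, norm_mul, Complex.norm_real, Real.norm_of_nonneg hR]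
    gcongr
  have hS := Complex.hasSum_deriv_of_summable_norm hu hdiff Metric.isOpen_ball hbound hzR
  have hF := ((Complex.differentiableOn_tsum_of_summable_norm hu hdiff Metric.isOpen_ball
    hbound).differentiableAt (Metric.isOpen_ball.mem_nhds hzR)).hasDerivAt
  have hcomb := ((summable_pow_div_Gamma_add ν (c * z)).hasSum.mul_left ν).add (hS.mul_left z)
  have hterm : ∀ n : ℕ, ν * ((c * z) ^ n / Complex.Gamma (ν + n + 1))
      + z * deriv (fun w : ℂ => (c * w) ^ n / Complex.Gamma (ν + n + 1)) z
      = (c * z) ^ n / Complex.Gamma (ν - 1 + n + 1) := by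
    intro n
    have hrec := Complex.one_div_Gamma_eq_self_mul_one_div_Gamma_add_one (ν + n)
    rw [(hd n z).deriv, show ν - 1 + n + 1 = ν + n by ring,
      div_eq_mul_inv _ (Complex.Gamma (ν + n)), hrec]
    cases n with
    | zero => simp [div_eq_mul_inv]
    | succ n => simp only [Nat.add_sub_cancel, pow_succ]; ring
  simp only [hterm] at hcomb
  have hprod := (hasDerivAt_id z).cpow_const (c := ν) hz |>.mul hF
  refine hprod.congr_deriv ?_
  simp only [id, millerRoss, hcomb.tsum_eq, Complex.cpow_sub _ _ hz0, Complex.cpow_one]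
  field_simp

/-- Theorem 4.2, component form: for a positive integer `m`, on the slit plane,
`(d^k/dz^k) E_{ν+m,c}(z) = E_{ν+m−k,c}(z)`. -/
theorem millerRoss_iteratedDeriv_shift (ν c : ℂ) (m : ℕ) (hm : 0 < m) (k : ℕ) (z : ℂ)
    (hz : 0 < z.re ∨ z.im ≠ 0) :
    iteratedDeriv k (millerRoss (ν + (m : ℂ)) c) z = millerRoss (ν + (m : ℂ) - (k : ℂ)) c z := by
  induction k generalizing z with
  | zero => simp
  | succ k ih =>
    have hev : iteratedDeriv k (millerRoss (ν + (m : ℂ)) c)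
        =ᶠ[nhds z] millerRoss (ν + (m : ℂ) - (k : ℂ)) c := by
      filter_upwards [Complex.isOpen_slitPlane.mem_nhds hz] with w hw using ih w hw
    rw [iteratedDeriv_succ, hev.deriv_eq, (hasDerivAt_millerRoss _ c hz).deriv]
    push_cast
    ring_nf
end
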